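/- Let a be a nonnegative integer and t an indeterminate. Then Σ_{λ ∈ 𝒫_n, λ ≤ (a,a,…,a)} s_λ(x) · det(T(λ))_{1 ≤ i,j ≤ n} = Π_{i=1}^n (1 − (x_i t)^{a+1})/(1 − x_i t), where the sum runs over partitions λ of length at most n with λ_1 ≤ a, the matrix T(λ) has (i,j)-entry t^{λ_i + j − i} if 0 ≤ λ_i + j − i ≤ a and 0 otherwise, and (1 − (x_i t)^{a+1})/(1 − x_i t) denotes the polynomial Σ_{k=0}^{a} (x_i t)^k. -/

import Mathlib

open Finset in
/-- The **Cauchy–Binet formula**, with minors indexed by strictly decreasing tuples. -/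
theorem Matrix.det_mul_eq_sum_strictAnti {R m : Type*} [CommRing R] [Fintype m] [LinearOrder m]
    {n : ℕ} (A : Matrix (Fin n) m R) (B : Matrix m (Fin n) R) :
    (A * B).det = ∑ q : Fin n → m with StrictAnti q,
      (A.submatrix id q).det * (B.submatrix q id).det := by
  have expand : (A * B).det =
      ∑ p : Fin n → m, (∏ i, A i (p i)) * (B.submatrix p id).det := by
    have rows : A * B = fun i => ∑ k, A i k • B k := by
      ext i j
      simp [Matrix.mul_apply]
    rw [rows]
    change Matrix.detRowAlternating.toMultilinearMap (fun i => ∑ k, A i k • B k) = _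
    rw [MultilinearMap.map_sum]
    refine sum_congr rfl fun p _ => ?_
    rw [MultilinearMap.map_smul_univ]
    rfl
  have inner (q : Fin n → m) : (A.submatrix id q).det * (B.submatrix q id).det =
      ∑ σ : Equiv.Perm (Fin n),
        (∏ i, A i ((q ∘ σ) i)) * (B.submatrix (q ∘ σ) id).det := by
    rw [← Matrix.det_transpose (A.submatrix id q), Matrix.det_apply', sum_mul]
    refine sum_congr rfl fun σ _ => ?_
    have h := Matrix.det_permute σ (B.submatrix q id)
    rw [Matrix.submatrix_submatrix, Function.id_comp] at h
    rw [h]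
    simp only [Matrix.transpose_apply, Matrix.submatrix_apply, id, Function.comp_apply]
    ring
  have support : ∑ p : Fin n → m, (∏ i, A i (p i)) * (B.submatrix p id).det =
      ∑ p : Fin n → m with Function.Injective p,
        (∏ i, A i (p i)) * (B.submatrix p id).det := by
    refine (sum_filter_of_ne fun p _ hp => ?_).symm
    by_contra hinj
    obtain ⟨i, j, hij, hne⟩ := Function.not_injective_iff.mp hinj
    refine hp ?_
    rw [Matrix.det_zero_of_row_eq hne, mul_zero]
    ext k
    simp [hij]
  rw [expand, support, sum_congr rfl fun q _ => inner q, ← sum_product']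
  refine (sum_bij (fun z _ => z.1 ∘ z.2) ?_ ?_ ?_ fun _ _ => rfl).symm
  · rintro ⟨q, σ⟩ h
    simp only [mem_product, mem_filter, mem_univ, true_and, and_true] at h ⊢
    exact h.injective.comp σ.injective
  · rintro ⟨q, σ⟩ h ⟨r, τ⟩ hr heq
    simp only [mem_product, mem_filter, mem_univ, true_and, and_true] at h hr heq
    have hq : q = r ∘ (τ * σ⁻¹ : Equiv.Perm (Fin n)) := by
      rw [Equiv.Perm.coe_mul, ← Function.comp_assoc, ← heq]
      ext i
      simp
    have hqq : q = r := by
      have := Tuple.unique_antitone (f := r) (σ := τ * σ⁻¹) (τ := 1)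
        (hq ▸ h.antitone) hr.antitone
      rw [hq, this]
      rfl
    subst hqq
    refine Prod.ext rfl (Equiv.ext fun i => h.injective ?_)
    exact congrFun heq i
  · intro p hp
    simp only [mem_filter, mem_univ, true_and] at hp
    let τ : Equiv.Perm (Fin n) := Fin.revPerm.trans (Tuple.sort p)
    refine ⟨(p ∘ τ, τ⁻¹), ?_, ?_⟩
    · simp only [mem_product, mem_filter, mem_univ, true_and, and_true]
      have hanti : Antitone (p ∘ τ) :=
        (Tuple.monotone_sort p).comp_antitone Fin.rev_anti
      exact hanti.strictAnti_of_injective (hp.comp τ.injective)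
    · ext i
      simp

theorem StrictAnti.add_sub_le {n : ℕ} {q : Fin n → ℕ} (hq : StrictAnti q) {i j : Fin n}
    (hij : i ≤ j) : q j + ((j : ℕ) - i) ≤ q i := by
  obtain ⟨j, hj⟩ := j
  induction j with
  | zero =>
    have : i = ⟨0, hj⟩ := le_antisymm hij (Fin.mk_le_of_le_val (Nat.zero_le _))
    simp [this]
  | succ k ih =>
    rcases hij.eq_or_lt with rfl | hlt
    · simp
    · have hik : (i : ℕ) ≤ k := Nat.lt_succ_iff.mp hlt
      have h₁ := ih (by lia) hik
      have h₂ : q ⟨k + 1, hj⟩ < q ⟨k, by lia⟩ := hq (Fin.mk_lt_mk.mpr (Nat.lt_succ_self k))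
      simp only at h₁ ⊢
      lia

open Finset in
/-- Adding the staircase identifies the partitions inside an `n × a` box with the strictly
decreasing `n`-tuples of integers in `[0, a + n)`. -/
theorem sum_strictAnti_eq_sum_antitone {M : Type*} [AddCommMonoid M] (n a : ℕ)
    (F : (Fin n → ℕ) → M) :
    ∑ q : Fin n → Fin (a + n) with StrictAnti q, F (fun i => q i) =
      ∑ lam ∈ Fintype.piFinset fun _ : Fin n => range (a + 1) with Antitone lam,
        F (fun i => lam i + (n - 1 - i)) := by
  have key (q : Fin n → Fin (a + n)) (hq : StrictAnti q) (i : Fin n) :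
      n - 1 - (i : ℕ) ≤ q i := by
    have hval : StrictAnti fun i => (q i : ℕ) := fun _ _ h => hq h
    have := hval.add_sub_le (i := i) (j := ⟨n - 1, Nat.sub_one_lt_of_lt i.isLt⟩)
      (Fin.mk_le_mk.mpr (Nat.le_sub_one_of_lt i.isLt))
    simp only at this
    lia
  refine sum_bij' (fun q _ i => (q i : ℕ) - (n - 1 - i))
    (fun lam hlam i => ⟨lam i + (n - 1 - i), ?_⟩) ?_ ?_ ?_ ?_ ?_
  · simp only [mem_filter, Fintype.mem_piFinset, mem_range] at hlam
    have := hlam.1 i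
    lia
  · intro q hq
    simp only [mem_filter, mem_univ, true_and, Fintype.mem_piFinset, mem_range] at hq ⊢
    have hval : StrictAnti fun i => (q i : ℕ) := fun _ _ h => hq h
    refine ⟨fun i => ?_, fun i j hij => ?_⟩
    · have := hval.add_sub_le (i := ⟨0, i.pos⟩) (j := i)
        (Fin.mk_le_of_le_val (Nat.zero_le _))
      have := (q ⟨0, i.pos⟩).isLt
      simp only at *
      lia
    · have := hval.add_sub_le hij
      have := key q hq j
      have : (i : ℕ) ≤ j := hij
      simp only at *
      lia
  · intro lam hlam
    simp only [mem_filter, mem_univ, true_and] at hlam ⊢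
    intro i j hij
    have := hlam.2 hij.le
    have : (i : ℕ) < j := hij
    refine Fin.mk_lt_mk.mpr ?_
    lia
  · intro q hq
    simp only [mem_filter, mem_univ, true_and] at hq
    ext i
    have := key q hq i
    simp only
    lia
  · intro lam _
    ext i
    simp
  · intro q hq
    simp only [mem_filter, mem_univ, true_and] at hq
    congr 1
    ext i
    have := key q hq i
    lia

open Finset in
theorem prod_geom_sum_mul_det_pow {R : Type*} [CommRing R] (n a : ℕ) (x : Fin n → R) (t : R) :
    (∏ j, ∑ k ∈ range (a + 1), (x j * t) ^ k) *
        (Matrix.of fun i j : Fin n => x j ^ (n - 1 - (i : ℕ))).det =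
      ∑ lam ∈ Fintype.piFinset fun _ : Fin n => range (a + 1) with Antitone lam,
        (Matrix.of fun i j : Fin n => x j ^ (lam i + (n - 1 - (i : ℕ)))).det *
          (Matrix.of fun i j : Fin n =>
            if (i : ℕ) ≤ lam i + (j : ℕ) ∧ lam i + (j : ℕ) - (i : ℕ) ≤ a then
              t ^ (lam i + (j : ℕ) - (i : ℕ)) else 0).det := by
  let c (i : Fin n) (m : ℕ) : R :=
    if n - 1 - (i : ℕ) ≤ m ∧ m - (n - 1 - i) ≤ a then t ^ (m - (n - 1 - i)) else 0
  let A : Matrix (Fin n) (Fin (a + n)) R := Matrix.of fun i m => c i m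
  let B : Matrix (Fin (a + n)) (Fin n) R := Matrix.of fun m j => x j ^ (m : ℕ)
  have hAB : (Matrix.of fun i j : Fin n =>
      (∑ k ∈ range (a + 1), (x j * t) ^ k) * x j ^ (n - 1 - (i : ℕ))) = A * B := by
    ext i j
    simp only [A, B, Matrix.mul_apply, Matrix.of_apply]
    rw [Fin.sum_univ_eq_sum_range (fun m => c i m * x j ^ m) (a + n), sum_mul]
    simp only [c, ite_mul, zero_mul]
    rw [← sum_filter]
    refine sum_bij' (fun k _ => k + (n - 1 - i)) (fun m _ => m - (n - 1 - i)) ?_ ?_ ?_ ?_ ?_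
    · intro k hk
      simp only [mem_range, mem_filter] at hk ⊢
      lia
    · intro m hm
      simp only [mem_range, mem_filter] at hm ⊢
      lia
    · intro k _
      lia
    · intro m hm
      simp only [mem_range, mem_filter] at hm
      lia
    · intro k _
      rw [Nat.add_sub_cancel, mul_pow, pow_add]
      ring
  rw [← Matrix.det_mul_row]
  simp only [Matrix.of_apply]
  rw [hAB, Matrix.det_mul_eq_sum_strictAnti]
  refine (sum_strictAnti_eq_sum_antitone n a fun q =>
    (Matrix.of fun i k => c i (q k)).det *
      (Matrix.of fun k j : Fin n => x j ^ q k).det).trans ?_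
  refine sum_congr rfl fun lam _ => ?_
  rw [mul_comm, ← Matrix.det_transpose (Matrix.of fun i k => c i _)]
  congr 2
  ext i j
  simp only [Matrix.transpose_apply, Matrix.of_apply, c]
  have hsub : lam i + (n - 1 - i) - (n - 1 - j) = lam i + (j : ℕ) - i := by lia
  rw [hsub]
  refine if_congr (and_congr_left fun _ => ?_) rfl rfl
  lia

theorem Matrix.det_pow_sub_ne_zero {R : Type*} [CommRing R] [IsDomain R] {n : ℕ} {x : Fin n → R}
    (hx : Function.Injective x) :
    (Matrix.of fun i j : Fin n => x j ^ (n - 1 - (i : ℕ))).det ≠ 0 := by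
  have h : (Matrix.of fun i j : Fin n => x j ^ (n - 1 - (i : ℕ))) =
      (Matrix.vandermonde x).transpose.submatrix Fin.revPerm id := by
    ext i j
    simp only [Matrix.of_apply, Matrix.submatrix_apply, Matrix.transpose_apply,
      Matrix.vandermonde_apply, Fin.revPerm_apply, Fin.val_rev, id]
    congr 1
    lia
  rw [h, Matrix.det_permute, Matrix.det_transpose]
  refine mul_ne_zero ?_ (Matrix.det_vandermonde_ne_zero_iff.mpr hx)
  exact ((Equiv.Perm.sign _).isUnit.map (Int.castRingHom R)).ne_zero

theorem stmt_14 (n a : ℕ)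
    (s : (Fin n → ℕ) → MvPolynomial (Fin n) ℚ)
    (hs : ∀ lam : Fin n → ℕ, Antitone lam →
      s lam * (Matrix.of fun i j : Fin n =>
          (MvPolynomial.X j : MvPolynomial (Fin n) ℚ) ^ (n - 1 - (i : ℕ))).det
        = (Matrix.of fun i j : Fin n =>
          (MvPolynomial.X j : MvPolynomial (Fin n) ℚ) ^ (lam i + (n - 1 - (i : ℕ)))).det) :
    ∑ᶠ (lam : Fin n → ℕ) (_ : Antitone lam ∧ ∀ i : Fin n, lam i ≤ a),
        MvPolynomial.rename (Sum.inl : Fin n → Fin n ⊕ Unit) (s lam) *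
          (Matrix.of fun i j : Fin n =>
            if (i : ℕ) ≤ lam i + (j : ℕ) ∧ lam i + (j : ℕ) - (i : ℕ) ≤ a then
              (MvPolynomial.X (Sum.inr ()) : MvPolynomial (Fin n ⊕ Unit) ℚ) ^
                (lam i + (j : ℕ) - (i : ℕ))
            else 0).det
    = ∏ i : Fin n, ∑ k ∈ Finset.range (a + 1),
        (MvPolynomial.X (Sum.inl i) * MvPolynomial.X (Sum.inr ()) :
          MvPolynomial (Fin n ⊕ Unit) ℚ) ^ k := by
  have map_det (e : Fin n → ℕ) :
      MvPolynomial.rename (Sum.inl : Fin n → Fin n ⊕ Unit)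
        (Matrix.of fun i j : Fin n => (MvPolynomial.X j : MvPolynomial (Fin n) ℚ) ^ e i).det =
      (Matrix.of fun i j : Fin n =>
        (MvPolynomial.X (Sum.inl j) : MvPolynomial (Fin n ⊕ Unit) ℚ) ^ e i).det := by
    rw [AlgHom.map_det]
    congr 1
    ext1 i j
    simp
  have hinj : Function.Injective fun j : Fin n =>
      (MvPolynomial.X (Sum.inl j) : MvPolynomial (Fin n ⊕ Unit) ℚ) :=
    MvPolynomial.X_injective.comp Sum.inl_injective
  refine mul_right_cancel₀ (Matrix.det_pow_sub_ne_zero hinj) ?_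
  rw [prod_geom_sum_mul_det_pow n a (fun j => MvPolynomial.X (Sum.inl j)),
    finsum_cond_eq_sum_of_cond_iff
      (t := {lam ∈ Fintype.piFinset fun _ : Fin n => Finset.range (a + 1) | Antitone lam})
      _ (by simp [and_comm]), Finset.sum_mul]
  refine Finset.sum_congr rfl fun lam hlam => ?_
  have h := congrArg (MvPolynomial.rename (Sum.inl : Fin n → Fin n ⊕ Unit))
    (hs lam (Finset.mem_filter.mp hlam).2)
  rw [map_mul, map_det fun i => n - 1 - i, map_det fun i => lam i + (n - 1 - i)] at h
  rw [← h]
  ring
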